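/- For every η>0 there exists R_η>0 such that for every optimal trajectory on [0,T] steering X₀=(0,0,π/2,0) to X₁=(x₁,y₁,θ₁,0) with |(x₁,y₁)| ≥ R_η, equipped with PMP adjoint data (ρ, φ̂, p₃, p₄), one has |φ̂−α| ≤ η and |ρ−1| ≤ η, where (x₁,y₁)=|(x₁,y₁)|(cos α, sin α) with α ∈ [0,2π) and the angle difference |φ̂−α| is taken modulo 2π with values in [0,π]. -/

import Mathlib

open MeasureTheory Real Set

noncomputable section

/-- Distance between two angles, computed modulo `2π`, with values in `[0, π]`. -/
def angleDist (a b : ℝ) : ℝ := ‖((a - b : ℝ) : Real.Angle)‖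

/-- Hypothesis (H1): `φ` and `ψ` are nonnegative, `C²`, even, nondecreasing on `[0,∞)`,
and vanish at `0`. -/
def H1 (φ ψ : ℝ → ℝ) : Prop :=
  (∀ r, 0 ≤ φ r) ∧ (∀ r, 0 ≤ ψ r) ∧
  ContDiff ℝ 2 φ ∧ ContDiff ℝ 2 ψ ∧
  (∀ r, φ (-r) = φ r) ∧ (∀ r, ψ (-r) = ψ r) ∧
  MonotoneOn φ (Set.Ici 0) ∧ MonotoneOn ψ (Set.Ici 0) ∧
  φ 0 = 0 ∧ ψ 0 = 0

/-- Hypothesis (H2): `ψ` is strictly convex with `ψ''(0) > 0`. -/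
def H2 (ψ : ℝ → ℝ) : Prop :=
  StrictConvexOn ℝ Set.univ ψ ∧ 0 < iteratedDeriv 2 ψ 0

/-- Hypothesis (H3): superlinear growth `ψ(r) ≥ C₀ |r|^p` for `|r| ≥ R₀`. -/
def H3 (ψ : ℝ → ℝ) (p C₀ R₀ : ℝ) : Prop :=
  1 < p ∧ 0 < C₀ ∧ 0 < R₀ ∧ ∀ r : ℝ, R₀ ≤ |r| → C₀ * |r| ^ p ≤ ψ r

/-- An admissible trajectory of the control system `x' = cos θ`, `y' = sin θ`,
`θ' = κ`, `κ' = u` on `[0, T]` steering `W₀` to `W₁`, with control `u ∈ L^p`;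
the final angle is prescribed modulo `2π`. -/
def Connects (p : ℝ) (x y θ κ u : ℝ → ℝ) (T : ℝ)
    (W₀ W₁ : ℝ × ℝ × ℝ × ℝ) : Prop :=
  0 < T ∧ Measurable u ∧
  IntegrableOn (fun t => |u t| ^ p) (Set.Icc 0 T) ∧
  x 0 = W₀.1 ∧ y 0 = W₀.2.1 ∧ θ 0 = W₀.2.2.1 ∧ κ 0 = W₀.2.2.2 ∧
  (∀ t ∈ Set.Icc (0:ℝ) T, x t = x 0 + ∫ s in (0:ℝ)..t, Real.cos (θ s)) ∧
  (∀ t ∈ Set.Icc (0:ℝ) T, y t = y 0 + ∫ s in (0:ℝ)..t, Real.sin (θ s)) ∧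
  (∀ t ∈ Set.Icc (0:ℝ) T, θ t = θ 0 + ∫ s in (0:ℝ)..t, κ s) ∧
  (∀ t ∈ Set.Icc (0:ℝ) T, κ t = κ 0 + ∫ s in (0:ℝ)..t, u s) ∧
  x T = W₁.1 ∧ y T = W₁.2.1 ∧ (∃ k : ℤ, θ T = W₁.2.2.1 + 2 * π * (k : ℝ)) ∧
  κ T = W₁.2.2.2

/-- The cost `C(u,T) = ∫₀ᵀ (1 + φ(κ(t)) + ψ(u(t))) dt`. -/
def cost (φ ψ κ u : ℝ → ℝ) (T : ℝ) : ℝ :=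
  ∫ t in (0:ℝ)..T, (1 + φ (κ t) + ψ (u t))

/-- Optimality: the trajectory is admissible and minimizes the cost among all
admissible trajectories steering `W₀` to `W₁`, over all final times. -/
def IsOptimal (φ ψ : ℝ → ℝ) (p : ℝ) (x y θ κ u : ℝ → ℝ) (T : ℝ)
    (W₀ W₁ : ℝ × ℝ × ℝ × ℝ) : Prop :=
  Connects p x y θ κ u T W₀ W₁ ∧
  ∀ x' y' θ' κ' u' : ℝ → ℝ, ∀ T' : ℝ, Connects p x' y' θ' κ' u' T' W₀ W₁ →
    cost φ ψ κ u T ≤ cost φ ψ κ' u' T'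

/-- The initial point `X₀ = (0, 0, π/2, 0)`. -/
def Xinit : ℝ × ℝ × ℝ × ℝ := (0, 0, π/2, 0)

/-- The constant `C_{φ,ψ} = 8√π (2 + ψ(1) + sup_{s∈[0,√(5π)]} φ(s))`. -/
def Cconst (φ ψ : ℝ → ℝ) : ℝ :=
  8 * Real.sqrt π * (2 + ψ 1 + sSup (φ '' Set.Icc 0 (Real.sqrt (5*π))))

/-- PMP adjoint data `(ρ, φ̂, p₃, p₄)` along a trajectory. -/
def PMPData (φ ψ : ℝ → ℝ) (θ κ u : ℝ → ℝ) (T ρ φh : ℝ) (p₃ p₄ : ℝ → ℝ) : Prop :=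
  0 < ρ ∧ φh ∈ Set.Ico 0 (2*π) ∧
  (∀ t ∈ Set.Icc (0:ℝ) T, p₃ t = p₃ 0 + ∫ s in (0:ℝ)..t, ρ * Real.sin (θ s - φh)) ∧
  (∀ t ∈ Set.Icc (0:ℝ) T, p₄ t = p₄ 0 + ∫ s in (0:ℝ)..t, (-(p₃ s) + deriv φ (κ s))) ∧
  (∀ᵐ t ∂(volume.restrict (Set.Icc (0:ℝ) T)), deriv ψ (u t) = p₄ t) ∧
  (∀ᵐ t ∂(volume.restrict (Set.Icc (0:ℝ) T)),
    ρ * Real.cos (θ t - φh) + p₃ t * κ t + p₄ t * u t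
      - (1 + φ (κ t) + ψ (u t)) = 0)

/-- `f` is the primitive of `g` on the whole line. -/
def IsPrimitive (f g : ℝ → ℝ) : Prop := ∀ t, f t = f 0 + ∫ s in (0:ℝ)..t, g s

/-- Follow `f` up to time `T`, then follow `g` started at time `0`. -/
def glue (T : ℝ) (f g : ℝ → ℝ) : ℝ → ℝ := fun t => if t ≤ T then f t else g (t - T)

lemma comp_glue (F : ℝ → ℝ) (T : ℝ) (f g : ℝ → ℝ) :
    (fun t => F (glue T f g t)) = glue T (fun t => F (f t)) (fun t => F (g t)) := by
  funext t; unfold glue; split_ifs <;> rfl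

lemma glue_of_le {T t : ℝ} (f g : ℝ → ℝ) (h : t ≤ T) : glue T f g t = f t := if_pos h

lemma integral_glue {T t : ℝ} {f g : ℝ → ℝ} (h0 : 0 ≤ T) (hT : T ≤ t)
    (hf : ∀ a b, IntervalIntegrable f volume a b) (hg : ∀ a b, IntervalIntegrable g volume a b) :
    ∫ s in (0:ℝ)..t, glue T f g s
      = (∫ s in (0:ℝ)..T, f s) + ∫ s in (0:ℝ)..(t - T), g s := by
  have e1 : EqOn f (glue T f g) (uIoo 0 T) := fun s hs => by
    rw [uIoo_of_le h0] at hs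
    exact (glue_of_le f g hs.2.le).symm
  have e2 : EqOn (fun s => g (s - T)) (glue T f g) (uIoo T t) := fun s hs => by
    rw [uIoo_of_le hT] at hs
    exact (if_neg (not_le.2 hs.1)).symm
  have hg' : IntervalIntegrable (fun s => g (s - T)) volume T t := by
    have := (hg 0 (t - T)).comp_sub_right T
    simpa using this
  rw [← intervalIntegral.integral_add_adjacent_intervals ((hf 0 T).congr_uIoo e1)
    (hg'.congr_uIoo e2), ← intervalIntegral.integral_congr_uIoo e1,
    ← intervalIntegral.integral_congr_uIoo e2, intervalIntegral.integral_comp_sub_right, sub_self]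

lemma IsPrimitive.glue {T : ℝ} {f₁ g₁ f₂ g₂ : ℝ → ℝ} (h0 : 0 ≤ T)
    (h1 : IsPrimitive f₁ g₁) (h2 : IsPrimitive f₂ g₂) (h : f₁ T = f₂ 0)
    (hg₁ : ∀ a b, IntervalIntegrable g₁ volume a b)
    (hg₂ : ∀ a b, IntervalIntegrable g₂ volume a b) :
    IsPrimitive (glue T f₁ f₂) (glue T g₁ g₂) := by
  intro t
  rw [glue_of_le _ _ h0]
  rcases le_or_gt t T with ht | ht
  · rw [glue_of_le _ _ ht, h1 t]
    congr 1
    refine intervalIntegral.integral_congr_uIoo fun s hs => (glue_of_le _ _ ?_).symm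
    exact hs.2.le.trans (max_le h0 ht)
  · rw [integral_glue h0 ht.le hg₁ hg₂, ← add_assoc, ← h1 T, h, ← h2 (t - T)]
    exact if_neg (not_le.2 ht)

lemma IsPrimitive.continuous {f g : ℝ → ℝ} (h : IsPrimitive f g)
    (hg : ∀ a b, IntervalIntegrable g volume a b) : Continuous f := by
  have : f = fun t => f 0 + ∫ s in (0:ℝ)..t, g s := funext h
  rw [this]
  exact continuous_const.add (intervalIntegral.continuous_primitive hg 0)

/-- A trajectory on the whole line with bounded measurable control, which moves from `W₀` to `W₁`
during `[0, T]`. -/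
structure Steers (x y θ κ u : ℝ → ℝ) (T : ℝ) (W₀ W₁ : ℝ × ℝ × ℝ × ℝ) : Prop where
  nonneg : 0 ≤ T
  meas : Measurable u
  bdd : ∃ B, ∀ t, |u t| ≤ B
  hx : IsPrimitive x (fun s => Real.cos (θ s))
  hy : IsPrimitive y (fun s => Real.sin (θ s))
  hθ : IsPrimitive θ κ
  hκ : IsPrimitive κ u
  init : (x 0, y 0, θ 0, κ 0) = W₀
  final : (x T, y T, θ T, κ T) = W₁

lemma intervalIntegrable_of_measurable_bounded {u : ℝ → ℝ} (hm : Measurable u)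
    (hb : ∃ B, ∀ t, |u t| ≤ B) (a b : ℝ) : IntervalIntegrable u volume a b := by
  obtain ⟨B, hB⟩ := hb
  refine (intervalIntegrable_const (c := B)).mono_fun hm.aestronglyMeasurable ?_
  exact Filter.Eventually.of_forall fun t => (hB t).trans (le_abs_self B)

namespace Steers

variable {x y θ κ u : ℝ → ℝ} {T : ℝ} {W₀ W₁ : ℝ × ℝ × ℝ × ℝ}

lemma integrable_u (h : Steers x y θ κ u T W₀ W₁) (a b : ℝ) :
    IntervalIntegrable u volume a b :=
  intervalIntegrable_of_measurable_bounded h.meas h.bdd a b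

lemma continuous_κ (h : Steers x y θ κ u T W₀ W₁) : Continuous κ :=
  h.hκ.continuous h.integrable_u

lemma continuous_θ (h : Steers x y θ κ u T W₀ W₁) : Continuous θ :=
  h.hθ.continuous fun a b => h.continuous_κ.intervalIntegrable a b

lemma integrable_cost (h : Steers x y θ κ u T W₀ W₁) {φ ψ : ℝ → ℝ} (hφ : Continuous φ)
    (hψ : Continuous ψ) (a b : ℝ) :
    IntervalIntegrable (fun t => 1 + φ (κ t) + ψ (u t)) volume a b := by
  refine IntervalIntegrable.add ?_ ?_
  · exact (continuous_const.add (hφ.comp h.continuous_κ)).intervalIntegrable a b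
  · refine intervalIntegrable_of_measurable_bounded (hψ.measurable.comp h.meas) ?_ a b
    obtain ⟨B, hB⟩ := h.bdd
    obtain ⟨M, hM⟩ := (isCompact_Icc (a := -B) (b := B)).exists_bound_of_continuousOn
      hψ.continuousOn
    exact ⟨M, fun t => hM _ (abs_le.1 (hB t))⟩

lemma trans {x' y' θ' κ' u' : ℝ → ℝ} {T' : ℝ} {W₂ : ℝ × ℝ × ℝ × ℝ}
    (h : Steers x y θ κ u T W₀ W₁) (h' : Steers x' y' θ' κ' u' T' W₁ W₂) :
    Steers (glue T x x') (glue T y y') (glue T θ θ') (glue T κ κ') (glue T u u') (T + T')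
      W₀ W₂ := by
  have hm := h.final.trans h'.init.symm
  simp only [Prod.mk.injEq] at hm
  have hT : ∀ f g : ℝ → ℝ, f T = g 0 → glue T f g (T + T') = g T' := fun f g hfg => by
    unfold glue
    split_ifs with hle
    · have : T' = 0 := le_antisymm (by linarith) h'.nonneg
      rw [this, add_zero, hfg]
    · rw [add_sub_cancel_left]
  refine ⟨add_nonneg h.nonneg h'.nonneg, ?_, ?_, ?_, ?_, ?_, ?_, ?_, ?_⟩
  · exact Measurable.ite measurableSet_Iic h.meas (h'.meas.comp (measurable_id.sub_const T))
  · obtain ⟨B, hB⟩ := h.bdd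
    obtain ⟨B', hB'⟩ := h'.bdd
    refine ⟨max B B', fun t => ?_⟩
    unfold glue
    split_ifs
    · exact (hB _).trans (le_max_left _ _)
    · exact (hB' _).trans (le_max_right _ _)
  · rw [comp_glue]
    exact h.hx.glue h.nonneg h'.hx hm.1
      (fun a b => (Real.continuous_cos.comp h.continuous_θ).intervalIntegrable a b)
      (fun a b => (Real.continuous_cos.comp h'.continuous_θ).intervalIntegrable a b)
  · rw [comp_glue]
    exact h.hy.glue h.nonneg h'.hy hm.2.1
      (fun a b => (Real.continuous_sin.comp h.continuous_θ).intervalIntegrable a b)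
      (fun a b => (Real.continuous_sin.comp h'.continuous_θ).intervalIntegrable a b)
  · exact h.hθ.glue h.nonneg h'.hθ hm.2.2.1
      (fun a b => h.continuous_κ.intervalIntegrable a b)
      (fun a b => h'.continuous_κ.intervalIntegrable a b)
  · exact h.hκ.glue h.nonneg h'.hκ hm.2.2.2 h.integrable_u h'.integrable_u
  · simp only [glue_of_le _ _ h.nonneg, h.init]
  · rw [hT x x' hm.1, hT y y' hm.2.1, hT θ θ' hm.2.2.1, hT κ κ' hm.2.2.2, h'.final]

lemma cost_trans {x' y' θ' κ' u' : ℝ → ℝ} {T' : ℝ} {W₂ : ℝ × ℝ × ℝ × ℝ}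
    (h : Steers x y θ κ u T W₀ W₁) (h' : Steers x' y' θ' κ' u' T' W₁ W₂)
    {φ ψ : ℝ → ℝ} (hφ : Continuous φ) (hψ : Continuous ψ) :
    cost φ ψ (glue T κ κ') (glue T u u') (T + T') = cost φ ψ κ u T + cost φ ψ κ' u' T' := by
  have e : (fun t => 1 + φ (glue T κ κ' t) + ψ (glue T u u' t))
      = glue T (fun t => 1 + φ (κ t) + ψ (u t)) (fun t => 1 + φ (κ' t) + ψ (u' t)) := by
    funext t; unfold glue; split_ifs <;> rfl
  unfold cost
  rw [e, integral_glue h.nonneg (by linarith [h'.nonneg]) (h.integrable_cost hφ hψ)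
    (h'.integrable_cost hφ hψ), add_sub_cancel_left]

end Steers

/-- The state `W₁` can be reached from `W₀` at cost at most `c`. -/
def Reach (φ ψ : ℝ → ℝ) (W₀ W₁ : ℝ × ℝ × ℝ × ℝ) (c : ℝ) : Prop :=
  ∃ x y θ κ u T, Steers x y θ κ u T W₀ W₁ ∧ cost φ ψ κ u T ≤ c

lemma Reach.trans {φ ψ : ℝ → ℝ} {W₀ W₁ W₂ : ℝ × ℝ × ℝ × ℝ} {c c' : ℝ}
    (h : Reach φ ψ W₀ W₁ c) (h' : Reach φ ψ W₁ W₂ c') (hφ : Continuous φ) (hψ : Continuous ψ) :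
    Reach φ ψ W₀ W₂ (c + c') := by
  obtain ⟨x, y, θ, κ, u, T, h, hc⟩ := h
  obtain ⟨x', y', θ', κ', u', T', h', hc'⟩ := h'
  refine ⟨_, _, _, _, _, _, h.trans h', ?_⟩
  rw [h.cost_trans h' hφ hψ]
  exact add_le_add hc hc'

lemma H1.le_of_abs_le {φ ψ : ℝ → ℝ} (h : H1 φ ψ) {r B : ℝ} (hr : |r| ≤ B) :
    φ r ≤ φ B ∧ ψ r ≤ ψ B := by
  obtain ⟨-, -, -, -, eφ, eψ, mφ, mψ, -, -⟩ := h
  have hB : 0 ≤ B := (abs_nonneg r).trans hr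
  have e1 : φ |r| = φ r := by rcases abs_choice r with h | h <;> simp [h, eφ]
  have e2 : ψ |r| = ψ r := by rcases abs_choice r with h | h <;> simp [h, eψ]
  exact ⟨e1 ▸ mφ (abs_nonneg r) hB hr, e2 ▸ mψ (abs_nonneg r) hB hr⟩

lemma reach_const {φ ψ : ℝ → ℝ} (h : H1 φ ψ) (θ₀ κ₀ c τ B : ℝ) (hτ : 0 ≤ τ)
    (hB : ∀ t ∈ Icc 0 τ, |κ₀ + c * t| ≤ B) (x₀ y₀ : ℝ) :
    Reach φ ψ (x₀, y₀, θ₀, κ₀)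
      (x₀ + ∫ s in (0:ℝ)..τ, Real.cos (θ₀ + κ₀ * s + c * s ^ 2 / 2),
        y₀ + ∫ s in (0:ℝ)..τ, Real.sin (θ₀ + κ₀ * s + c * s ^ 2 / 2),
        θ₀ + κ₀ * τ + c * τ ^ 2 / 2, κ₀ + c * τ) (τ * (1 + φ B + ψ |c|)) := by
  have hs : Steers (fun t => x₀ + ∫ s in (0:ℝ)..t, Real.cos (θ₀ + κ₀ * s + c * s ^ 2 / 2))
      (fun t => y₀ + ∫ s in (0:ℝ)..t, Real.sin (θ₀ + κ₀ * s + c * s ^ 2 / 2))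
      (fun t => θ₀ + κ₀ * t + c * t ^ 2 / 2) (fun t => κ₀ + c * t) (fun _ => c) τ
      (x₀, y₀, θ₀, κ₀) (x₀ + ∫ s in (0:ℝ)..τ, Real.cos (θ₀ + κ₀ * s + c * s ^ 2 / 2),
        y₀ + ∫ s in (0:ℝ)..τ, Real.sin (θ₀ + κ₀ * s + c * s ^ 2 / 2),
        θ₀ + κ₀ * τ + c * τ ^ 2 / 2, κ₀ + c * τ) := by
    refine ⟨hτ, measurable_const, ⟨|c|, fun _ => le_rfl⟩, ?_, ?_, ?_, ?_, by simp, rfl⟩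
    · intro t; simp
    · intro t; simp
    · intro t
      have : ∀ s : ℝ, HasDerivAt (fun t => θ₀ + κ₀ * t + c * t ^ 2 / 2) (κ₀ + c * s) s := by
        intro s
        have := (((hasDerivAt_id s).const_mul κ₀).const_add θ₀).add
          (((hasDerivAt_pow 2 s).const_mul c).div_const 2)
        refine HasDerivAt.congr_deriv this ?_
        simp; ring
      rw [intervalIntegral.integral_eq_sub_of_hasDerivAt (fun s _ => this s)
        (by apply Continuous.intervalIntegrable; fun_prop)]
      ring
    · intro t; simp [mul_comm]
  refine ⟨_, _, _, _, _, _, hs, ?_⟩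
  unfold cost
  have : ∫ _ in (0:ℝ)..τ, (1 + φ B + ψ |c|) = τ * (1 + φ B + ψ |c|) := by
    rw [intervalIntegral.integral_const, sub_zero, smul_eq_mul]
  rw [← this]
  refine intervalIntegral.integral_mono_on hτ
    (hs.integrable_cost h.2.2.1.continuous h.2.2.2.1.continuous 0 τ) (by simp) fun t ht => ?_
  have h1 := (h.le_of_abs_le (hB t ht)).1
  have h2 := (h.le_of_abs_le (le_refl |c|)).2
  linarith

lemma Reach.mono {φ ψ : ℝ → ℝ} {W₀ W₁ : ℝ × ℝ × ℝ × ℝ} {c c' : ℝ} (h : Reach φ ψ W₀ W₁ c)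
    (hc : c ≤ c') : Reach φ ψ W₀ W₁ c' := by
  obtain ⟨x, y, θ, κ, u, T, h, h'⟩ := h
  exact ⟨x, y, θ, κ, u, T, h, h'.trans hc⟩

lemma abs_integral_le_of_abs_le_one {f : ℝ → ℝ} (hf : ∀ t, |f t| ≤ 1) {τ : ℝ} (hτ : 0 ≤ τ) :
    |∫ s in (0:ℝ)..τ, f s| ≤ τ := by
  have := intervalIntegral.norm_integral_le_of_norm_le_const (a := 0) (b := τ) (C := 1) (f := f)
    (fun t _ => hf t)
  simpa [abs_of_nonneg hτ] using this

lemma reach_straight {φ ψ : ℝ → ℝ} (h : H1 φ ψ) (x₀ y₀ θ₀ : ℝ) {l : ℝ} (hl : 0 ≤ l) :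
    Reach φ ψ (x₀, y₀, θ₀, 0) (x₀ + l * Real.cos θ₀, y₀ + l * Real.sin θ₀, θ₀, 0) l := by
  have := reach_const h θ₀ 0 0 l 0 hl (by simp) x₀ y₀
  simpa [h.2.2.2.2.2.2.2.2.1, h.2.2.2.2.2.2.2.2.2] using this

lemma reach_turn {φ ψ : ℝ → ℝ} (h : H1 φ ψ) (θ₀ θ₁ : ℝ) (hd : |θ₁ - θ₀| ≤ 7) :
    ∃ dx dy : ℝ, |dx| ≤ 2 ∧ |dy| ≤ 2 ∧ ∀ x₀ y₀,
      Reach φ ψ (x₀, y₀, θ₀, 0) (x₀ + dx, y₀ + dy, θ₁, 0) (2 * (1 + φ 7 + ψ 7)) := by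
  set d := θ₁ - θ₀ with hdef
  have hb : ∀ r ∈ Icc (0:ℝ) 1, |d * r| ≤ 7 := fun r hr => by
    rw [abs_mul, abs_of_nonneg hr.1]
    nlinarith [hr.1, hr.2, abs_nonneg d]
  have hA := reach_const h θ₀ 0 d 1 7 zero_le_one (fun t ht => by simpa using hb t ht)
  have hB := reach_const h (θ₀ + d / 2) d (-d) 1 7 zero_le_one (fun t ht => by
    have := hb (1 - t) ⟨by linarith [ht.2], by linarith [ht.1]⟩
    rwa [show d + -d * t = d * (1 - t) by ring])
  refine ⟨(∫ s in (0:ℝ)..1, Real.cos (θ₀ + 0 * s + d * s ^ 2 / 2))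
      + ∫ s in (0:ℝ)..1, Real.cos (θ₀ + d / 2 + d * s + (-d) * s ^ 2 / 2),
    (∫ s in (0:ℝ)..1, Real.sin (θ₀ + 0 * s + d * s ^ 2 / 2))
      + ∫ s in (0:ℝ)..1, Real.sin (θ₀ + d / 2 + d * s + (-d) * s ^ 2 / 2), ?_, ?_, ?_⟩
  · refine (abs_add_le _ _).trans ?_
    have h1 := abs_integral_le_of_abs_le_one
      (fun s => Real.abs_cos_le_one (θ₀ + 0 * s + d * s ^ 2 / 2)) zero_le_one
    have h2 := abs_integral_le_of_abs_le_one
      (fun s => Real.abs_cos_le_one (θ₀ + d / 2 + d * s + (-d) * s ^ 2 / 2)) zero_le_one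
    linarith
  · refine (abs_add_le _ _).trans ?_
    have h1 := abs_integral_le_of_abs_le_one
      (fun s => Real.abs_sin_le_one (θ₀ + 0 * s + d * s ^ 2 / 2)) zero_le_one
    have h2 := abs_integral_le_of_abs_le_one
      (fun s => Real.abs_sin_le_one (θ₀ + d / 2 + d * s + (-d) * s ^ 2 / 2)) zero_le_one
    linarith
  · intro x₀ y₀
    have a := hA x₀ y₀
    rw [show θ₀ + 0 * 1 + d * 1 ^ 2 / 2 = θ₀ + d / 2 by ring,
      show 0 + d * 1 = d by ring] at a
    have b := a.trans (hB _ _) h.2.2.1.continuous h.2.2.2.1.continuous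
    rw [show θ₀ + d / 2 + d * 1 + -d * 1 ^ 2 / 2 = θ₁ by rw [hdef]; ring,
      show d + -d * 1 = 0 by ring, add_assoc x₀, add_assoc y₀] at b
    refine b.mono ?_
    have h2 := (h.le_of_abs_le (hb 1 (by simp))).2
    rw [mul_one] at h2
    have h3 : ψ |d| ≤ ψ 7 := (h.le_of_abs_le (r := |d|) (by rwa [abs_abs])).2
    have h4 : ψ |-d| ≤ ψ 7 := by rwa [abs_neg]
    linarith

lemma reach_turn_straight {φ ψ : ℝ → ℝ} (h : H1 φ ψ) (θ₀ θ₁ : ℝ) (hd : |θ₁ - θ₀| ≤ 7) :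
    ∃ dx dy : ℝ, |dx| ≤ 2 ∧ |dy| ≤ 2 ∧ ∀ x₀ y₀ l, 0 ≤ l →
      Reach φ ψ (x₀, y₀, θ₀, 0)
        (x₀ + dx + l * Real.cos θ₁, y₀ + dy + l * Real.sin θ₁, θ₁, 0)
        (2 * (1 + φ 7 + ψ 7) + l) := by
  obtain ⟨dx, dy, h1, h2, h3⟩ := reach_turn h θ₀ θ₁ hd
  exact ⟨dx, dy, h1, h2, fun x₀ y₀ l hl => (h3 x₀ y₀).trans (reach_straight h _ _ _ hl)
    h.2.2.1.continuous h.2.2.2.1.continuous⟩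

lemma Steers.connects {x y θ κ u : ℝ → ℝ} {T x₁ y₁ θ₁ θ₂ p : ℝ} {k : ℤ} (hp : 0 < p)
    (h : Steers x y θ κ u T Xinit (x₁, y₁, θ₂, 0)) (hT : 0 < T)
    (hθ : θ₂ = θ₁ + 2 * π * (k : ℝ)) : Connects p x y θ κ u T Xinit (x₁, y₁, θ₁, 0) := by
  have hi := h.init
  have hf := h.final
  simp only [Xinit, Prod.mk.injEq] at hi hf
  refine ⟨hT, h.meas, ?_, hi.1, hi.2.1, hi.2.2.1, hi.2.2.2, fun t _ => h.hx t, fun t _ => h.hy t,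
    fun t _ => h.hθ t, fun t _ => h.hκ t, hf.1, hf.2.1, ⟨k, hf.2.2.1.trans hθ⟩, hf.2.2.2⟩
  obtain ⟨B, hB⟩ := h.bdd
  refine Measure.integrableOn_of_bounded (M := B ^ p) (by simp)
    (h.meas.abs.pow_const p).aestronglyMeasurable (Filter.Eventually.of_forall fun t => ?_)
  rw [Real.norm_of_nonneg (by positivity)]
  exact Real.rpow_le_rpow (abs_nonneg _) (hB t) hp.le

/-- Every target is reached at a cost which exceeds its distance by a bounded amount. -/
lemma exists_competitor {φ ψ : ℝ → ℝ} {p : ℝ} (hp : 0 < p) (h : H1 φ ψ) {L α : ℝ} (hL : 1 ≤ L)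
    (hα : α ∈ Ico 0 (2 * π)) (θ₁ : ℝ) :
    ∃ x y θ κ u T, Connects p x y θ κ u T Xinit (L * Real.cos α, L * Real.sin α, θ₁, 0) ∧
      cost φ ψ κ u T ≤ L + (12 * (1 + φ 7 + ψ 7) + 24) := by
  have hpi := Real.pi_gt_three
  have hpi' := Real.pi_lt_d2
  have hcφ := h.2.2.1.continuous
  have hcψ := h.2.2.2.1.continuous
  obtain ⟨k, hk⟩ : ∃ k : ℤ, toIcoMod Real.two_pi_pos 0 θ₁ = θ₁ + 2 * π * (k : ℝ) := by
    refine ⟨-toIcoDiv Real.two_pi_pos 0 θ₁, ?_⟩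
    rw [toIcoMod]; push_cast; rw [zsmul_eq_mul]; ring
  set θ₂ := toIcoMod Real.two_pi_pos 0 θ₁ with hθ₂
  have hmem : θ₂ ∈ Ico 0 (0 + 2 * π) := toIcoMod_mem_Ico _ _ _
  obtain ⟨a1, b1, ha1, hb1, r1⟩ := reach_turn_straight h (π / 2) π
    (by rw [abs_le]; constructor <;> linarith)
  obtain ⟨a2, b2, ha2, hb2, r2⟩ := reach_turn_straight h π (3 * π / 2)
    (by rw [abs_le]; constructor <;> linarith)
  obtain ⟨a3, b3, ha3, hb3, r3⟩ := reach_turn_straight h (3 * π / 2) (2 * π)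
    (by rw [abs_le]; constructor <;> linarith)
  obtain ⟨a4, b4, ha4, hb4, r4⟩ := reach_turn_straight h (2 * π) (5 * π / 2)
    (by rw [abs_le]; constructor <;> linarith)
  obtain ⟨a5, b5, ha5, hb5, r5⟩ := reach_turn_straight h (5 * π / 2) (α + 2 * π)
    (by rw [abs_le]; constructor <;> linarith [hα.1, hα.2])
  obtain ⟨a6, b6, ha6, hb6, r6⟩ := reach_turn h (α + 2 * π) (θ₂ + 2 * π)
    (by rw [abs_le]; constructor <;> linarith [hα.1, hα.2, hmem.1, hmem.2])
  set Dx := a1 + a2 + a3 + a4 + a5 + a6 with hDx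
  set Dy := b1 + b2 + b3 + b4 + b5 + b6 with hDy
  have R := (((((r1 0 0 (max Dx 0) (le_max_right _ _)).trans
    (r2 _ _ (max Dy 0) (le_max_right _ _)) hcφ hcψ).trans
    (r3 _ _ (max (-Dx) 0) (le_max_right _ _)) hcφ hcψ).trans
    (r4 _ _ (max (-Dy) 0) (le_max_right _ _)) hcφ hcψ).trans
    (r5 _ _ L (by linarith)) hcφ hcψ).trans (r6 _ _) hcφ hcψ
  have c2 : Real.cos (3 * π / 2) = 0 := by
    rw [show 3 * π / 2 = π / 2 + π by ring, Real.cos_add_pi, Real.cos_pi_div_two, neg_zero]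
  have s2 : Real.sin (3 * π / 2) = -1 := by
    rw [show 3 * π / 2 = π / 2 + π by ring, Real.sin_add_pi, Real.sin_pi_div_two]
  have c4 : Real.cos (5 * π / 2) = 0 := by
    rw [show 5 * π / 2 = π / 2 + 2 * π by ring, Real.cos_add_two_pi, Real.cos_pi_div_two]
  have s4 : Real.sin (5 * π / 2) = 1 := by
    rw [show 5 * π / 2 = π / 2 + 2 * π by ring, Real.sin_add_two_pi, Real.sin_pi_div_two]
  have mx : max Dx 0 - max (-Dx) 0 = Dx := by
    rcases le_total Dx 0 with h | h
    · rw [max_eq_right h, max_eq_left (by linarith)]; ring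
    · rw [max_eq_left h, max_eq_right (by linarith)]; ring
  have my : max Dy 0 - max (-Dy) 0 = Dy := by
    rcases le_total Dy 0 with h | h
    · rw [max_eq_right h, max_eq_left (by linarith)]; ring
    · rw [max_eq_left h, max_eq_right (by linarith)]; ring
  have mx' : max Dx 0 + max (-Dx) 0 = |Dx| := by
    rcases le_total Dx 0 with h | h
    · rw [max_eq_right h, max_eq_left (by linarith), abs_of_nonpos h]; ring
    · rw [max_eq_left h, max_eq_right (by linarith), abs_of_nonneg h]; ring
  have my' : max Dy 0 + max (-Dy) 0 = |Dy| := by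
    rcases le_total Dy 0 with h | h
    · rw [max_eq_right h, max_eq_left (by linarith), abs_of_nonpos h]; ring
    · rw [max_eq_left h, max_eq_right (by linarith), abs_of_nonneg h]; ring
  rw [c2, s2, c4, s4, Real.cos_pi, Real.sin_pi, Real.cos_two_pi, Real.sin_two_pi,
    Real.cos_add_two_pi, Real.sin_add_two_pi] at R
  obtain ⟨x, y, θ, κ, u, T, hS, hcost⟩ := R
  rw [abs_le] at ha1 ha2 ha3 ha4 ha5 ha6 hb1 hb2 hb3 hb4 hb5 hb6
  have hDx12 : |Dx| ≤ 12 := by rw [abs_le]; constructor <;> linarith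
  have hDy12 : |Dy| ≤ 12 := by rw [abs_le]; constructor <;> linarith
  have hS' : Steers x y θ κ u T Xinit (L * Real.cos α, L * Real.sin α, θ₂ + 2 * π, 0) := by
    refine ⟨hS.1, hS.2, hS.3, hS.4, hS.5, hS.6, hS.7, hS.init, hS.final.trans ?_⟩
    simp only [Prod.mk.injEq, and_true]
    constructor <;> linarith
  refine ⟨x, y, θ, κ, u, T, hS'.connects (k := k + 1) hp ?_ ?_, hcost.trans ?_⟩
  · refine lt_of_le_of_ne hS'.nonneg fun h0 => ?_
    have hf := hS'.final
    have hi := hS'.init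
    rw [← h0, hi] at hf
    simp only [Xinit, Prod.mk.injEq] at hf
    have := Real.sin_sq_add_cos_sq α
    have h1 : Real.cos α = 0 := by
      rcases mul_eq_zero.1 hf.1.symm with h | h
      · linarith
      · exact h
    have h2 : Real.sin α = 0 := by
      rcases mul_eq_zero.1 hf.2.1.symm with h | h
      · linarith
      · exact h
    rw [h1, h2] at this
    norm_num at this
  · push_cast; rw [hk]; ring
  · linarith

lemma norm_coe_angle_le {x η : ℝ} (hη : 0 ≤ η) (h : Real.cos η ≤ Real.cos x) :
    ‖(x : Real.Angle)‖ ≤ η := by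
  have hx : ‖(x : Real.Angle)‖ = |x - round ((2 * π)⁻¹ * x) * (2 * π)| :=
    AddCircle.norm_eq (2 * π)
  have hle : ‖(x : Real.Angle)‖ ≤ π := by
    have : ‖(x : Real.Angle)‖ ≤ |2 * π| / 2 :=
      AddCircle.norm_le_half_period (2 * π) (x := (x : AddCircle (2 * π))) (by positivity)
    rwa [abs_of_pos Real.two_pi_pos, mul_div_cancel_left₀ _ two_ne_zero] at this
  have hcos : Real.cos ‖(x : Real.Angle)‖ = Real.cos x := by
    rw [hx, Real.cos_abs, Real.cos_sub_int_mul_two_pi]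
  by_contra! hlt
  have := Real.cos_lt_cos_of_nonneg_of_le_pi hη hle hlt
  linarith

lemma exists_unit_interval {c : ℝ → ℝ} {T C ε : ℝ} {N : ℕ} (hN : 0 < N) (hNT : (N : ℝ) ≤ T)
    (hc : IntervalIntegrable c volume 0 T) (h0 : ∀ t, 0 ≤ c t) (hC : ∫ t in (0:ℝ)..T, c t ≤ C)
    (hCN : C ≤ N * ε) : ∃ a, 0 ≤ a ∧ a + 1 ≤ T ∧ ∫ t in a..(a + 1), c t ≤ ε := by
  by_contra! hcon
  have hT : 0 ≤ T := (Nat.cast_nonneg N).trans hNT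
  have hsub : ∀ a b : ℝ, 0 ≤ a → a ≤ b → b ≤ T → IntervalIntegrable c volume a b :=
    fun a b h1 h2 h3 => hc.mono_set (by
      rw [uIcc_of_le h2, uIcc_of_le hT]; exact Icc_subset_Icc h1 h3)
  have hk : ∀ k < N, (k : ℝ) + 1 ≤ T := fun k hk => by
    have : (k : ℝ) + 1 ≤ N := by exact_mod_cast hk
    linarith
  have hsum := intervalIntegral.sum_integral_adjacent_intervals (f := c) (μ := volume)
    (a := fun k : ℕ => (k : ℝ)) (n := N) (fun k hkN => by
      push_cast
      exact hsub _ _ (Nat.cast_nonneg k) (by linarith) (hk k hkN))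
  have hlt : ∑ _k ∈ Finset.range N, ε
      < ∑ k ∈ Finset.range N, ∫ t in ((k : ℕ) : ℝ)..((k + 1 : ℕ) : ℝ), c t := by
    refine Finset.sum_lt_sum_of_nonempty ⟨0, Finset.mem_range.2 hN⟩ fun k hkN => ?_
    push_cast
    exact hcon k (Nat.cast_nonneg k) (hk k (Finset.mem_range.1 hkN))
  rw [hsum] at hlt
  have hmono := intervalIntegral.integral_mono_interval (f := c) (μ := volume) (c := 0) (d := T)
    (a := 0) (b := N) le_rfl (Nat.cast_nonneg N) hNT
    (Filter.Eventually.of_forall fun t => h0 t) hc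
  simp at hlt
  linarith

lemma exists_point_le {c : ℝ → ℝ} {P : ℝ → Prop} {s ε : ℝ} (hε : 0 < ε)
    (hc : IntervalIntegrable c volume s (s + 1 / 5)) (h : ∫ t in s..(s + 1 / 5), c t ≤ ε)
    (hP : ∀ᵐ t ∂(volume.restrict (Icc s (s + 1 / 5))), P t) :
    ∃ t ∈ Icc s (s + 1 / 5), c t ≤ 6 * ε ∧ P t := by
  by_contra! hcon
  have : ∫ _ in s..(s + 1 / 5), 6 * ε ≤ ∫ t in s..(s + 1 / 5), c t := by
    refine intervalIntegral.integral_mono_ae_restrict (by linarith) (by simp) hc ?_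
    filter_upwards [hP, ae_restrict_mem measurableSet_Icc] with t ht hm
    by_contra hlt
    exact hcon t hm (not_le.1 hlt).le ht
  rw [intervalIntegral.integral_const, smul_eq_mul] at this
  linarith

lemma H1.abs_le_add {φ ψ : ℝ → ℝ} (h : H1 φ ψ) (hc : StrictConvexOn ℝ univ ψ) {δ : ℝ}
    (hδ : 0 < δ) : 0 < ψ δ ∧ ∀ r, |r| ≤ δ + δ / ψ δ * ψ r := by
  obtain ⟨-, pψ, -, -, -, eψ, -, mψ, -, zψ⟩ := h
  have hpos : 0 < ψ δ := by
    have := hc.2 (mem_univ δ) (mem_univ (-δ)) (by linarith)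
      (show (0:ℝ) < 1 / 2 by norm_num) (show (0:ℝ) < 1 / 2 by norm_num) (by norm_num)
    simp only [smul_eq_mul, eψ] at this
    rw [show 1 / 2 * δ + 1 / 2 * -δ = 0 by ring, zψ] at this
    linarith
  refine ⟨hpos, fun r => ?_⟩
  have e : ψ |r| = ψ r := by rcases abs_choice r with h | h <;> simp [h, eψ]
  have hnn : 0 ≤ δ / ψ δ * ψ r := mul_nonneg (by positivity) (pψ r)
  rcases le_or_gt |r| δ with hr | hr
  · linarith
  · have hr0 : 0 < |r| := hδ.trans hr
    have := hc.convexOn.2 (mem_univ |r|) (mem_univ 0)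
      (show 0 ≤ δ / |r| by positivity)
      (show 0 ≤ 1 - δ / |r| by rw [sub_nonneg, div_le_one hr0]; exact hr.le) (by ring)
    simp only [smul_eq_mul, mul_zero, add_zero, zψ, e] at this
    rw [div_mul_cancel₀ _ hr0.ne'] at this
    have h2 : |r| ≤ δ / ψ δ * ψ r := by
      rw [div_mul_eq_mul_div, le_div_iff₀ hpos]
      rw [div_mul_eq_mul_div, le_div_iff₀ hr0] at this
      linarith
    linarith

lemma sub_eq_integral {f g : ℝ → ℝ} {T : ℝ} (hT : 0 ≤ T)
    (hg : IntervalIntegrable g volume 0 T)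
    (h : ∀ t ∈ Icc (0:ℝ) T, f t = f 0 + ∫ s in (0:ℝ)..t, g s) :
    ContinuousOn f (Icc 0 T) ∧ ∀ s ∈ Icc 0 T, ∀ t ∈ Icc 0 T, f t - f s = ∫ r in s..t, g r := by
  have hsub : ∀ t ∈ Icc (0:ℝ) T, IntervalIntegrable g volume 0 t := fun t ht =>
    hg.mono_set (by rw [uIcc_of_le ht.1, uIcc_of_le hT]; exact Icc_subset_Icc le_rfl ht.2)
  refine ⟨?_, fun s hs t ht => ?_⟩
  · have : ContinuousOn (fun t => f 0 + ∫ s in (0:ℝ)..t, g s) (Icc 0 T) := by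
      have := intervalIntegral.continuousOn_primitive_interval (f := g) (a := 0) (b := T)
        (μ := volume) (by
          rw [uIcc_of_le hT, integrableOn_Icc_iff_integrableOn_Ioc]
          exact (intervalIntegrable_iff_integrableOn_Ioc_of_le hT).1 hg)
      rw [uIcc_of_le hT] at this
      exact continuousOn_const.add this
    exact this.congr h
  · rw [h t ht, h s hs, ← intervalIntegral.integral_interval_sub_left (hsub t ht) (hsub s hs)]
    ring

lemma abs_curvature_le {θ κ u : ℝ → ℝ} {a α δ ε s₁ s₃ : ℝ} (hε : ε ≤ 1 / 10) (hδ : 0 < δ)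
    (hθ : ∀ s ∈ Icc a (a + 1), ∀ t ∈ Icc a (a + 1), θ t - θ s = ∫ r in s..t, κ r)
    (hκ : ∀ s ∈ Icc a (a + 1), ∀ t ∈ Icc a (a + 1), κ t - κ s = ∫ r in s..t, u r)
    (cθ : ContinuousOn θ (Icc a (a + 1))) (cκ : ContinuousOn κ (Icc a (a + 1)))
    (iu : IntervalIntegrable (fun t => |u t|) volume a (a + 1))
    (hu : ∫ t in a..(a + 1), |u t| ≤ 2 * δ)
    (hcos : ∫ t in a..(a + 1), (1 - Real.cos (θ t - α)) ≤ ε)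
    (h₁ : s₁ ∈ Icc a (a + 1 / 5)) (h₃ : s₃ ∈ Icc (a + 4 / 5) (a + 1))
    (hs₁ : |Real.sin (θ s₁ - α)| ≤ δ) (hs₃ : |Real.sin (θ s₃ - α)| ≤ δ) :
    ∀ t ∈ Icc a (a + 1), |κ t| ≤ 10 * δ := by
  have m₁ : s₁ ∈ Icc a (a + 1) := ⟨h₁.1, by linarith [h₁.2]⟩
  have m₃ : s₃ ∈ Icc a (a + 1) := ⟨by linarith [h₃.1], h₃.2⟩
  have hle : s₁ ≤ s₃ := by linarith [h₁.2, h₃.1]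
  have hsub : Icc s₁ s₃ ⊆ Icc a (a + 1) := Icc_subset_Icc m₁.1 m₃.2
  have hosc : ∀ t ∈ Icc a (a + 1), |κ t - κ s₁| ≤ 2 * δ := fun t ht => by
    rw [hκ s₁ m₁ t ht]
    refine (intervalIntegral.norm_integral_le_integral_norm_uIoc (f := u)).trans ?_
    refine le_trans ?_ hu
    rw [intervalIntegral.integral_of_le (by linarith)]
    refine setIntegral_mono_set ((intervalIntegrable_iff_integrableOn_Ioc_of_le (by linarith)).1 iu)
      (Filter.Eventually.of_forall fun t => abs_nonneg _) (Filter.Eventually.of_forall ?_)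
    exact Ioc_subset_Ioc (le_min m₁.1 ht.1) (max_le m₁.2 ht.2)
  set k := κ s₁ with hk
  have hsincos : ContinuousOn (fun t => κ t * Real.cos (θ t - α)) (Icc a (a + 1)) :=
    cκ.mul (Real.continuous_cos.comp_continuousOn (cθ.sub continuousOn_const))
  have hcc : ContinuousOn (fun t => 1 - Real.cos (θ t - α)) (Icc a (a + 1)) :=
    continuousOn_const.sub (Real.continuous_cos.comp_continuousOn (cθ.sub continuousOn_const))
  have icc : IntervalIntegrable (fun t => 1 - Real.cos (θ t - α)) volume a (a + 1) :=
    ContinuousOn.intervalIntegrable (by rwa [uIcc_of_le (by linarith)])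
  have i13 : IntervalIntegrable (fun t => κ t * Real.cos (θ t - α)) volume s₁ s₃ :=
    ContinuousOn.intervalIntegrable (by rw [uIcc_of_le hle]; exact hsincos.mono hsub)
  have icc13 : IntervalIntegrable (fun t => 1 - Real.cos (θ t - α)) volume s₁ s₃ :=
    ContinuousOn.intervalIntegrable (by rw [uIcc_of_le hle]; exact hcc.mono hsub)
  have hftc : ∫ t in s₁..s₃, κ t * Real.cos (θ t - α)
      = Real.sin (θ s₃ - α) - Real.sin (θ s₁ - α) := by
    refine intervalIntegral.integral_eq_sub_of_hasDerivAt_of_le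
      (f := fun t => Real.sin (θ t - α)) hle
      ((Real.continuous_sin.comp_continuousOn (cθ.sub continuousOn_const)).mono hsub)
      (fun t ht => ?_) i13
    have hd : HasDerivAt θ (κ t) t := by
      have hI : HasDerivAt (fun r => θ s₁ + ∫ v in s₁..r, κ v) (κ t) t := by
        refine (intervalIntegral.integral_hasDerivAt_right ?_ ?_ ?_).const_add _
        · refine ContinuousOn.intervalIntegrable ?_
          rw [uIcc_of_le ht.1.le]
          exact cκ.mono (Icc_subset_Icc m₁.1 (ht.2.le.trans m₃.2))
        · exact ContinuousOn.stronglyMeasurableAtFilter isOpen_Ioo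
            (cκ.mono (Ioo_subset_Icc_self.trans hsub)) t ht
        · exact cκ.continuousAt (Icc_mem_nhds (m₁.1.trans_lt ht.1) (ht.2.trans_le m₃.2))
      refine hI.congr_of_eventuallyEq ?_
      filter_upwards [Ioo_mem_nhds ht.1 ht.2] with r hr
      rw [← hθ s₁ m₁ r (hsub ⟨hr.1.le, hr.2.le⟩)]
      ring
    have := (hd.sub_const α).sin
    rwa [mul_comm] at this
  have hcos13 : ∫ t in s₁..s₃, (1 - Real.cos (θ t - α)) ≤ ε :=
    (intervalIntegral.integral_mono_interval m₁.1 hle m₃.2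
      (Filter.Eventually.of_forall fun t => by
        simpa using Real.cos_le_one (θ t - α)) icc).trans hcos
  have hdiff : |∫ t in s₁..s₃, (k - κ t * Real.cos (θ t - α))|
      ≤ ∫ t in s₁..s₃, (|k| * (1 - Real.cos (θ t - α)) + 2 * δ) := by
    refine intervalIntegral.norm_integral_le_of_norm_le
      (f := fun t => k - κ t * Real.cos (θ t - α)) hle
      (Filter.Eventually.of_forall fun t ht => ?_)
      ((icc13.const_mul _).add intervalIntegrable_const)
    have e : k - κ t * Real.cos (θ t - α)
        = k * (1 - Real.cos (θ t - α)) - (κ t - k) * Real.cos (θ t - α) := by ring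
    rw [e, Real.norm_eq_abs]
    refine (abs_sub _ _).trans ?_
    rw [abs_mul, abs_mul, abs_of_nonneg (sub_nonneg.2 (Real.cos_le_one _))]
    have h1 := hosc t (hsub (Ioc_subset_Icc_self ht))
    have h2 := Real.abs_cos_le_one (θ t - α)
    have := mul_le_mul h1 h2 (abs_nonneg _) (by positivity)
    linarith
  rw [intervalIntegral.integral_sub (by simp) i13, hftc,
    intervalIntegral.integral_add (icc13.const_mul _) intervalIntegrable_const,
    intervalIntegral.integral_const_mul, intervalIntegral.integral_const,
    intervalIntegral.integral_const, smul_eq_mul, smul_eq_mul] at hdiff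
  have hlen : 3 / 5 ≤ s₃ - s₁ := by linarith [h₁.2, h₃.1]
  have hlen' : s₃ - s₁ ≤ 1 := by linarith [h₁.1, h₃.2]
  have hk1 : (s₃ - s₁) * |k| ≤ |k| * ε + 2 * δ + 2 * δ := by
    have e : (s₃ - s₁) * |k| = |(s₃ - s₁) * k| := by
      rw [abs_mul, abs_of_nonneg (by linarith : 0 ≤ s₃ - s₁)]
    have h1 := mul_le_mul_of_nonneg_left hcos13 (abs_nonneg k)
    have h2 : (s₃ - s₁) * (2 * δ) ≤ 1 * (2 * δ) :=
      mul_le_mul_of_nonneg_right hlen' (by positivity)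
    rw [abs_le] at hdiff hs₁ hs₃
    rw [e, abs_le]
    constructor <;> linarith [hdiff.1, hdiff.2, hs₁.1, hs₁.2, hs₃.1, hs₃.2]
  have hk8 : |k| ≤ 8 * δ := by nlinarith [abs_nonneg k]
  intro t ht
  have h1 := hosc t ht
  have h2 := abs_add_le (κ t - k) k
  rw [sub_add_cancel] at h2
  linarith

lemma abs_costate_taylor_le {φ θ κ p₃ p₄ : ℝ → ℝ} {a β ρ φh δ ω s : ℝ} (hρ : 0 < ρ)
    (hθ : ∀ s ∈ Icc a (a + 1), ∀ t ∈ Icc a (a + 1), θ t - θ s = ∫ r in s..t, κ r)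
    (hp₃ : ∀ s ∈ Icc a (a + 1), ∀ t ∈ Icc a (a + 1),
      p₃ t - p₃ s = ∫ r in s..t, ρ * Real.sin (θ r - φh))
    (hp₄ : ∀ s ∈ Icc a (a + 1), ∀ t ∈ Icc a (a + 1),
      p₄ t - p₄ s = ∫ r in s..t, (-(p₃ r) + deriv φ (κ r)))
    (cθ : ContinuousOn θ (Icc a (a + 1))) (cκ : ContinuousOn κ (Icc a (a + 1)))
    (c₃ : ContinuousOn p₃ (Icc a (a + 1))) (cφ : Continuous (deriv φ))
    (hδ : ∀ t ∈ Icc a (a + 1), |κ t| ≤ δ) (hω : ∀ t ∈ Icc a (a + 1), |deriv φ (κ t)| ≤ ω)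
    (hs : s ∈ Icc a (a + 1)) (hβ : θ s = β) :
    ∀ t ∈ Icc a (a + 1), |p₄ t - p₄ s + p₃ s * (t - s)
      + ρ * Real.sin (β - φh) * (t - s) ^ 2 / 2| ≤ ρ * δ + ω := by
  have hδ0 : 0 ≤ δ := (abs_nonneg _).trans (hδ s hs)
  have hω0 : 0 ≤ ω := (abs_nonneg _).trans (hω s hs)
  have hunit : ∀ t ∈ Icc a (a + 1), |t - s| ≤ 1 := fun t ht => by
    rw [abs_le]; constructor <;> linarith [ht.1, ht.2, hs.1, hs.2]
  have hsub : ∀ t ∈ Icc a (a + 1), uIcc s t ⊆ Icc a (a + 1) := fun t ht =>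
    uIcc_subset_Icc hs ht
  have bound : ∀ (f : ℝ → ℝ) (M : ℝ), 0 ≤ M → (∀ r ∈ Icc a (a + 1), |f r| ≤ M) →
      ∀ t ∈ Icc a (a + 1), |∫ r in s..t, f r| ≤ M := fun f M hM hf t ht => by
    have := intervalIntegral.norm_integral_le_of_norm_le_const (a := s) (b := t) (C := M) (f := f)
      (fun r hr => hf r (hsub t ht (uIoc_subset_uIcc hr)))
    rw [Real.norm_eq_abs] at this
    nlinarith [hunit t ht]
  have b1 : ∀ t ∈ Icc a (a + 1), |θ t - β| ≤ δ := fun t ht => by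
    rw [← hβ, hθ s hs t ht]
    exact bound κ δ hδ0 hδ t ht
  have b2 : ∀ t ∈ Icc a (a + 1), |p₃ t - p₃ s - ρ * Real.sin (β - φh) * (t - s)| ≤ ρ * δ := by
    intro t ht
    have i1 : IntervalIntegrable (fun r => ρ * Real.sin (θ r - φh)) volume s t :=
      ContinuousOn.intervalIntegrable ((continuousOn_const.mul
        (Real.continuous_sin.comp_continuousOn (cθ.sub continuousOn_const))).mono (hsub t ht))
    have e : p₃ t - p₃ s - ρ * Real.sin (β - φh) * (t - s)
        = ∫ r in s..t, (ρ * Real.sin (θ r - φh) - ρ * Real.sin (β - φh)) := by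
      rw [intervalIntegral.integral_sub i1 (by simp), ← hp₃ s hs t ht,
        intervalIntegral.integral_const, smul_eq_mul]
      ring
    rw [e]
    refine bound _ _ (by positivity) (fun r hr => ?_) t ht
    rw [← mul_sub, abs_mul, abs_of_pos hρ]
    refine mul_le_mul_of_nonneg_left ((Real.abs_sin_sub_sin_le _ _).trans ?_) hρ.le
    rw [sub_sub_sub_cancel_right]
    exact b1 r hr
  intro t ht
  have i1 : IntervalIntegrable (fun r => -(p₃ r) + deriv φ (κ r)) volume s t :=
    ContinuousOn.intervalIntegrable ((c₃.neg.add (cφ.comp_continuousOn cκ)).mono (hsub t ht))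
  have i2 : IntervalIntegrable (fun r => p₃ s + ρ * Real.sin (β - φh) * (r - s)) volume s t := by
    apply Continuous.intervalIntegrable; fun_prop
  have i3 : ∫ r in s..t, (p₃ s + ρ * Real.sin (β - φh) * (r - s))
      = p₃ s * (t - s) + ρ * Real.sin (β - φh) * (t - s) ^ 2 / 2 := by
    rw [intervalIntegral.integral_add (by simp) (by apply Continuous.intervalIntegrable; fun_prop),
      intervalIntegral.integral_const, intervalIntegral.integral_const_mul,
      intervalIntegral.integral_sub (by simp) (by simp), integral_id,
      intervalIntegral.integral_const, smul_eq_mul, smul_eq_mul]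
    ring
  have e : p₄ t - p₄ s + p₃ s * (t - s) + ρ * Real.sin (β - φh) * (t - s) ^ 2 / 2
      = ∫ r in s..t, ((-(p₃ r) + deriv φ (κ r))
        + (p₃ s + ρ * Real.sin (β - φh) * (r - s))) := by
    rw [intervalIntegral.integral_add i1 i2, ← hp₄ s hs t ht, i3]
    ring
  rw [e]
  refine bound _ _ (by positivity) (fun r hr => ?_) t ht
  have h1 := abs_le.1 (b2 r hr)
  have h2 := abs_le.1 (hω r hr)
  rw [abs_le]
  constructor <;> linarith [h1.1, h1.2, h2.1, h2.2]

lemma abs_sin_le_of_taylor {q S A B E : ℝ} (hA : 1 / 5 ≤ A) (hA1 : A ≤ 1) (hB : 1 / 5 ≤ B)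
    (h1 : |q * A + S * A ^ 2 / 2| ≤ E) (h2 : |-(q * B) + S * B ^ 2 / 2| ≤ E) :
    |S| ≤ 50 * E ∧ |q| ≤ 30 * E := by
  have hE : 0 ≤ E := (abs_nonneg _).trans h1
  have k1 : |q + S * A / 2| ≤ 5 * E := by
    have e : q * A + S * A ^ 2 / 2 = (q + S * A / 2) * A := by ring
    rw [e, abs_mul, abs_of_pos (by linarith : 0 < A)] at h1
    nlinarith [abs_nonneg (q + S * A / 2)]
  have k2 : |-q + S * B / 2| ≤ 5 * E := by
    have e : -(q * B) + S * B ^ 2 / 2 = (-q + S * B / 2) * B := by ring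
    rw [e, abs_mul, abs_of_pos (by linarith : 0 < B)] at h2
    nlinarith [abs_nonneg (-q + S * B / 2)]
  have k3 : |S| ≤ 50 * E := by
    have h3 := (abs_add_le (q + S * A / 2) (-q + S * B / 2)).trans (add_le_add k1 k2)
    have e : q + S * A / 2 + (-q + S * B / 2) = S * ((A + B) / 2) := by ring
    rw [e, abs_mul, abs_of_pos (by linarith : 0 < (A + B) / 2)] at h3
    nlinarith [abs_nonneg S]
  refine ⟨k3, ?_⟩
  have h4 := abs_sub (q + S * A / 2) (S * A / 2)
  rw [add_sub_cancel_right, abs_div, abs_mul, abs_of_pos (by linarith : 0 < A), abs_two] at h4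
  nlinarith [abs_nonneg S]

lemma polar_close {ρ x ν : ℝ} (hρ : 0 < ρ) (hν : 0 < ν) (hν' : ν ≤ 1 / 8)
    (hs : |ρ * Real.sin x| ≤ ν * (1 + ρ)) (hc : |ρ * Real.cos x - 1| ≤ ν * (1 + ρ)) :
    |ρ - 1| ≤ 6 * ν ∧ 1 - 9 * ν ≤ Real.cos x := by
  have h1 : ρ ≤ |ρ * Real.cos x| + |ρ * Real.sin x| := by
    have h2 : 1 ≤ |Real.cos x| + |Real.sin x| := by
      nlinarith [Real.sin_sq_add_cos_sq x, abs_nonneg (Real.cos x), abs_nonneg (Real.sin x),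
        sq_abs (Real.cos x), sq_abs (Real.sin x)]
    rw [abs_mul, abs_mul, abs_of_pos hρ]
    nlinarith
  have h2 : |ρ * Real.cos x| ≤ 1 + ν * (1 + ρ) := by
    rw [abs_le] at hc ⊢
    constructor <;> nlinarith [hc.1, hc.2]
  have h3 : ρ ≤ 2 := by nlinarith
  have h4 : ν * (1 + ρ) ≤ 3 * ν := by nlinarith
  rw [abs_le] at hc
  have h5 : 1 - 3 * ν ≤ ρ := by nlinarith [Real.cos_le_one x, hc.1]
  have h6 : ρ ≤ 1 + 6 * ν := by linarith
  refine ⟨by rw [abs_le]; constructor <;> linarith, ?_⟩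
  by_contra! hlt
  have : ρ * Real.cos x < 1 - 3 * ν := by
    rcases le_or_gt (1 - 9 * ν) 0 with h | h
    · nlinarith
    · nlinarith
  linarith [hc.1]

lemma exists_deriv_small {f : ℝ → ℝ} (hf : ContDiff ℝ 2 f) (he : ∀ r, f (-r) = f r)
    {σ : ℝ} (hσ : 0 < σ) : ∃ r > 0, ∀ x, |x| ≤ r → |deriv f x| ≤ σ := by
  have hc : Continuous (deriv f) := hf.continuous_deriv (by norm_num)
  have h0 : deriv f 0 = 0 := by
    have h1 := deriv_comp_neg f 0
    have h2 : (fun x => f (-x)) = f := funext he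
    rw [h2, neg_zero] at h1
    linarith
  obtain ⟨r, hr, h⟩ := Metric.continuousAt_iff.1 (hc.continuousAt (x := (0:ℝ))) σ hσ
  refine ⟨r / 2, by positivity, fun x hx => ?_⟩
  have := @h x (by rw [Real.dist_eq, sub_zero]; linarith)
  rw [Real.dist_eq, h0, sub_zero] at this
  exact this.le

lemma exists_phase {φ ψ θ κ u p₃ p₄ : ℝ → ℝ} (h1 : H1 φ ψ) (h2 : StrictConvexOn ℝ univ ψ)
    {a α ρ φh σ δ δ₂ ε : ℝ} (hρ : 0 < ρ) (hσ : 0 < σ) (hσ1 : σ ≤ 1) (hδ : 0 < δ)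
    (hδ₂σ : δ₂ ≤ σ) (hδδ₂ : 10 * δ ≤ δ₂)
    (hφδ : ∀ x, |x| ≤ δ₂ → |deriv φ x| ≤ σ) (hψδ : ∀ x, |x| ≤ δ → |deriv ψ x| ≤ σ)
    (hε : 0 < ε) (hε1 : ε ≤ 1 / 10) (hεδ : 12 * ε ≤ δ ^ 2) (hεψ : 6 * ε < ψ δ)
    (hεσ : 6 * ε ≤ σ)
    (hθ : ∀ s ∈ Icc a (a + 1), ∀ t ∈ Icc a (a + 1), θ t - θ s = ∫ r in s..t, κ r)
    (hκ : ∀ s ∈ Icc a (a + 1), ∀ t ∈ Icc a (a + 1), κ t - κ s = ∫ r in s..t, u r)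
    (hp₃ : ∀ s ∈ Icc a (a + 1), ∀ t ∈ Icc a (a + 1),
      p₃ t - p₃ s = ∫ r in s..t, ρ * Real.sin (θ r - φh))
    (hp₄ : ∀ s ∈ Icc a (a + 1), ∀ t ∈ Icc a (a + 1),
      p₄ t - p₄ s = ∫ r in s..t, (-(p₃ r) + deriv φ (κ r)))
    (cθ : ContinuousOn θ (Icc a (a + 1))) (cκ : ContinuousOn κ (Icc a (a + 1)))
    (c₃ : ContinuousOn p₃ (Icc a (a + 1)))
    (iu : IntervalIntegrable u volume a (a + 1))
    (ic : IntervalIntegrable (fun t => 1 + φ (κ t) + ψ (u t) - Real.cos (θ t - α))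
      volume a (a + 1))
    (hc : ∫ t in a..(a + 1), (1 + φ (κ t) + ψ (u t) - Real.cos (θ t - α)) ≤ ε)
    (hu : ∀ᵐ t ∂(volume.restrict (Icc a (a + 1))), deriv ψ (u t) = p₄ t)
    (hH : ∀ᵐ t ∂(volume.restrict (Icc a (a + 1))),
      ρ * Real.cos (θ t - φh) + p₃ t * κ t + p₄ t * u t - (1 + φ (κ t) + ψ (u t)) = 0) :
    ∃ β, 1 - 6 * ε ≤ Real.cos (β - α) ∧
      |ρ * Real.sin (β - φh)| ≤ 151 * σ * (1 + ρ) ∧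
      |ρ * Real.cos (β - φh) - 1| ≤ 151 * σ * (1 + ρ) := by
  obtain ⟨hψpos, hψlin⟩ := h1.abs_le_add h2 hδ
  have pφ := h1.1
  have pψ := h1.2.1
  set c : ℝ → ℝ := fun t => 1 + φ (κ t) + ψ (u t) - Real.cos (θ t - α) with hcdef
  have hc0 : ∀ t, 0 ≤ c t := fun t => by
    have := Real.cos_le_one (θ t - α)
    simp only [hcdef]; linarith [pφ (κ t), pψ (u t)]
  have hpoint : ∀ s, a ≤ s → s + 1 / 5 ≤ a + 1 → ∃ t ∈ Icc s (s + 1 / 5), c t ≤ 6 * ε ∧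
      (deriv ψ (u t) = p₄ t ∧
      ρ * Real.cos (θ t - φh) + p₃ t * κ t + p₄ t * u t - (1 + φ (κ t) + ψ (u t)) = 0) := by
    intro s hs hs'
    refine exists_point_le hε (ic.mono_set ?_) ?_ ?_
    · rw [uIcc_of_le (by linarith), uIcc_of_le (by linarith)]
      exact Icc_subset_Icc hs hs'
    · exact (intervalIntegral.integral_mono_interval hs (by linarith) hs'
        (Filter.Eventually.of_forall hc0) ic).trans hc
    · exact ae_restrict_of_ae_restrict_of_subset (Icc_subset_Icc hs hs') (hu.and hH)
  have hsmall : ∀ t, c t ≤ 6 * ε → deriv ψ (u t) = p₄ t →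
      |u t| ≤ δ ∧ |p₄ t| ≤ σ ∧ |Real.sin (θ t - α)| ≤ δ := by
    intro t ht hp
    have hcos := Real.cos_le_one (θ t - α)
    simp only [hcdef] at ht
    have hut : |u t| ≤ δ := by
      by_contra! hlt
      have := (h1.le_of_abs_le (r := δ) (B := |u t|) (by rw [abs_of_pos hδ]; exact hlt.le)).2
      have e : ψ |u t| = ψ (u t) := by
        rcases abs_choice (u t) with h | h <;> simp [h, h1.2.2.2.2.2.1]
      linarith [pφ (κ t)]
    refine ⟨hut, hp ▸ hψδ _ hut, ?_⟩
    refine abs_le_of_sq_le_sq ?_ hδ.le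
    have := Real.sin_sq_add_cos_sq (θ t - α)
    nlinarith [pφ (κ t), pψ (u t), Real.neg_one_le_cos (θ t - α)]
  obtain ⟨s₁, m₁, k₁, e₁, -⟩ := hpoint a le_rfl (by linarith)
  obtain ⟨s₂, m₂, k₂, e₂, H₂⟩ := hpoint (a + 2 / 5) (by linarith) (by linarith)
  obtain ⟨s₃, m₃, k₃, e₃, -⟩ := hpoint (a + 4 / 5) (by linarith) (by linarith)
  obtain ⟨-, q₁, r₁⟩ := hsmall s₁ k₁ e₁
  obtain ⟨v₂, q₂, -⟩ := hsmall s₂ k₂ e₂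
  obtain ⟨-, q₃, r₃⟩ := hsmall s₃ k₃ e₃
  have M₁ : s₁ ∈ Icc a (a + 1) := ⟨m₁.1, by linarith [m₁.2]⟩
  have M₂ : s₂ ∈ Icc a (a + 1) := ⟨by linarith [m₂.1], by linarith [m₂.2]⟩
  have M₃ : s₃ ∈ Icc a (a + 1) := ⟨by linarith [m₃.1], by linarith [m₃.2]⟩
  have hIu : ∫ t in a..(a + 1), |u t| ≤ 2 * δ := by
    have h3 : ∫ t in a..(a + 1), |u t| ≤ ∫ t in a..(a + 1), (δ + δ / ψ δ * c t) := by
      refine intervalIntegral.integral_mono_on (by linarith) iu.abs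
        (intervalIntegrable_const.add (ic.const_mul _)) fun t _ => (hψlin (u t)).trans ?_
      have : ψ (u t) ≤ c t := by
        have := Real.cos_le_one (θ t - α)
        simp only [hcdef]; linarith [pφ (κ t)]
      gcongr
    rw [intervalIntegral.integral_add intervalIntegrable_const (ic.const_mul _),
      intervalIntegral.integral_const_mul, intervalIntegral.integral_const, smul_eq_mul] at h3
    have h4 : δ / ψ δ * ∫ t in a..(a + 1), c t ≤ δ := by
      rw [div_mul_eq_mul_div, div_le_iff₀ hψpos]
      exact mul_le_mul_of_nonneg_left (by linarith) hδ.le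
    linarith
  have hIcos : ∫ t in a..(a + 1), (1 - Real.cos (θ t - α)) ≤ ε := by
    refine le_trans (intervalIntegral.integral_mono_on (by linarith) ?_ ic fun t _ => ?_) hc
    · refine ContinuousOn.intervalIntegrable ?_
      rw [uIcc_of_le (by linarith)]
      exact continuousOn_const.sub
        (Real.continuous_cos.comp_continuousOn (cθ.sub continuousOn_const))
    · linarith [pφ (κ t), pψ (u t)]
  have hκδ : ∀ t ∈ Icc a (a + 1), |κ t| ≤ δ₂ := fun t ht =>
    (abs_curvature_le hε1 hδ hθ hκ cθ cκ iu.abs hIu hIcos m₁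
      ⟨m₃.1, M₃.2⟩ r₁ r₃ t ht).trans hδδ₂
  have htay := abs_costate_taylor_le hρ hθ hp₃ hp₄ cθ cκ c₃
    (h1.2.2.1.continuous_deriv (by norm_num)) hκδ (fun t ht => hφδ _ (hκδ t ht)) M₂ rfl
  have hE : ρ * δ₂ ≤ ρ * σ := mul_le_mul_of_nonneg_left hδ₂σ hρ.le
  have t₁ := abs_le.1 (htay s₁ M₁)
  have t₃ := abs_le.1 (htay s₃ M₃)
  rw [abs_le] at q₁ q₃
  have q₂' := abs_le.1 q₂
  obtain ⟨hS, hq⟩ := abs_sin_le_of_taylor (q := p₃ s₂) (S := ρ * Real.sin (θ s₂ - φh))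
    (A := s₃ - s₂) (B := s₂ - s₁) (E := ρ * σ + 3 * σ) (by linarith [m₂.2, m₃.1])
    (by linarith [M₃.2, M₂.1]) (by linarith [m₁.2, m₂.1])
    (by rw [abs_le]; constructor <;> linarith [t₃.1, t₃.2])
    (by
      have e : -(p₃ s₂ * (s₂ - s₁)) + ρ * Real.sin (θ s₂ - φh) * (s₂ - s₁) ^ 2 / 2
        = p₃ s₂ * (s₁ - s₂) + ρ * Real.sin (θ s₂ - φh) * (s₁ - s₂) ^ 2 / 2 := by ring
      rw [e, abs_le]; constructor <;> linarith [t₁.1, t₁.2])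
  have hρσ : 0 < ρ * σ := mul_pos hρ hσ
  refine ⟨θ s₂, ?_, by linarith, ?_⟩
  · simp only [hcdef] at k₂
    linarith [pφ (κ s₂), pψ (u s₂)]
  · have hqκ : |p₃ s₂ * κ s₂| ≤ 30 * (ρ * σ + 3 * σ) := by
      rw [abs_mul]
      have := hκδ s₂ M₂
      have h3 : |κ s₂| ≤ 1 := by linarith
      exact (mul_le_mul hq h3 (abs_nonneg _) (by positivity)).trans (by linarith)
    have hpu : |p₄ s₂ * u s₂| ≤ σ := by
      rw [abs_mul]
      have h3 : |u s₂| ≤ 1 := by linarith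
      exact (mul_le_mul q₂ h3 (abs_nonneg _) hσ.le).trans (by linarith)
    have hcs := Real.cos_le_one (θ s₂ - α)
    simp only [hcdef] at k₂
    have e : ρ * Real.cos (θ s₂ - φh) - 1
        = φ (κ s₂) + ψ (u s₂) - p₃ s₂ * κ s₂ - p₄ s₂ * u s₂ := by linarith
    rw [abs_le] at hqκ hpu
    rw [e, abs_le]
    constructor <;> linarith [pφ (κ s₂), pψ (u s₂), hqκ.1, hqκ.2, hpu.1, hpu.2]

lemma exists_phase_of_optimal {φ ψ : ℝ → ℝ} {p C ε : ℝ} (hp : 1 < p) (h1 : H1 φ ψ)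
    {N : ℕ} (hN : 0 < N) (hCN : C ≤ N * ε) {x y θ κ u p₃ p₄ : ℝ → ℝ} {T ρ φh L α θ₁ : ℝ}
    (hNL : (N : ℝ) ≤ L)
    (hcon : Connects p x y θ κ u T Xinit (L * Real.cos α, L * Real.sin α, θ₁, 0))
    (hcost : cost φ ψ κ u T ≤ L + C) (hpmp : PMPData φ ψ θ κ u T ρ φh p₃ p₄)
    (h2 : StrictConvexOn ℝ univ ψ) {σ δ δ₂ : ℝ} (hσ : 0 < σ) (hσ1 : σ ≤ 1) (hδ : 0 < δ)
    (hδ₂σ : δ₂ ≤ σ) (hδδ₂ : 10 * δ ≤ δ₂)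
    (hφδ : ∀ x, |x| ≤ δ₂ → |deriv φ x| ≤ σ) (hψδ : ∀ x, |x| ≤ δ → |deriv ψ x| ≤ σ)
    (hε : 0 < ε) (hε1 : ε ≤ 1 / 10) (hεδ : 12 * ε ≤ δ ^ 2) (hεψ : 6 * ε < ψ δ)
    (hεσ : 6 * ε ≤ σ) :
    ∃ β, 1 - 6 * ε ≤ Real.cos (β - α) ∧
      |ρ * Real.sin (β - φh)| ≤ 151 * σ * (1 + ρ) ∧
      |ρ * Real.cos (β - φh) - 1| ≤ 151 * σ * (1 + ρ) := by
  obtain ⟨hT, mu, iup, x0, y0, -, -, hx, hy, hθ, hκ, hxT, hyT, -, -⟩ := hcon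
  obtain ⟨hρ, -, hp₃, hp₄, hu, hH⟩ := hpmp
  have hT0 := hT.le
  have memT : T ∈ Icc 0 T := ⟨hT0, le_rfl⟩
  have toII : ∀ {f : ℝ → ℝ}, ContinuousOn f (Icc 0 T) → IntervalIntegrable f volume 0 T :=
    fun hf => ContinuousOn.intervalIntegrable (by rwa [uIcc_of_le hT0])
  have iu : IntervalIntegrable u volume 0 T := by
    rw [intervalIntegrable_iff_integrableOn_Icc_of_le hT0]
    refine Integrable.mono' (g := fun t => 1 + |u t| ^ p) ?_ mu.aestronglyMeasurable ?_
    · exact Integrable.add (integrableOn_const (by simp)) iup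
    · refine Filter.Eventually.of_forall fun t => ?_
      rw [Real.norm_eq_abs]
      have hnn : 0 ≤ |u t| ^ p := by positivity
      rcases le_total |u t| 1 with h | h
      · linarith
      · have := Real.rpow_le_rpow_of_exponent_le h hp.le
        rw [Real.rpow_one] at this
        linarith
  obtain ⟨cκ, dκ⟩ := sub_eq_integral hT0 iu hκ
  obtain ⟨cθ, dθ⟩ := sub_eq_integral hT0 (toII cκ) hθ
  have cθs : ∀ b, ContinuousOn (fun t => θ t - b) (Icc 0 T) := fun b => cθ.sub continuousOn_const
  obtain ⟨c₃, d₃⟩ := sub_eq_integral hT0 (toII (continuousOn_const.mul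
    (Real.continuous_sin.comp_continuousOn (cθs φh)))) hp₃
  have cφκ : ContinuousOn (fun t => φ (κ t)) (Icc 0 T) :=
    h1.2.2.1.continuous.comp_continuousOn cκ
  obtain ⟨c₄, d₄⟩ := sub_eq_integral hT0 (toII (c₃.neg.add
    ((h1.2.2.1.continuous_deriv (by norm_num)).comp_continuousOn cκ))) hp₄
  have iψ : IntervalIntegrable (fun t => ψ (u t)) volume 0 T := by
    have i1 : IntervalIntegrable (fun t => (ρ * Real.cos (θ t - φh) + p₃ t * κ t - 1 - φ (κ t))
        + p₄ t * u t) volume 0 T := by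
      refine (toII ?_).add (iu.continuousOn_mul (by rwa [uIcc_of_le hT0]))
      exact (((continuousOn_const.mul (Real.continuous_cos.comp_continuousOn (cθs φh))).add
        (c₃.mul cκ)).sub continuousOn_const).sub cφκ
    refine i1.congr_ae ?_
    have : ∀ᵐ t ∂(volume.restrict (uIoc 0 T)), ρ * Real.cos (θ t - φh) + p₃ t * κ t
        + p₄ t * u t - (1 + φ (κ t) + ψ (u t)) = 0 :=
      ae_restrict_of_ae_restrict_of_subset
        (by rw [uIoc_of_le hT0]; exact Ioc_subset_Icc_self) hH
    filter_upwards [this] with t ht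
    linarith
  have icost : IntervalIntegrable (fun t => 1 + φ (κ t) + ψ (u t)) volume 0 T :=
    (toII (continuousOn_const.add cφκ)).add iψ
  have icos : IntervalIntegrable (fun t => Real.cos (θ t - α)) volume 0 T :=
    toII (Real.continuous_cos.comp_continuousOn (cθs α))
  have hcosL : ∫ t in (0:ℝ)..T, Real.cos (θ t - α) = L := by
    have e : ∀ t, Real.cos (θ t - α)
        = Real.cos α * Real.cos (θ t) + Real.sin α * Real.sin (θ t) := fun t => by
      rw [Real.cos_sub]; ring
    simp_rw [e]
    have i1 : IntervalIntegrable (fun t => Real.cos (θ t)) volume 0 T :=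
      toII (Real.continuous_cos.comp_continuousOn cθ)
    have i2 : IntervalIntegrable (fun t => Real.sin (θ t)) volume 0 T :=
      toII (Real.continuous_sin.comp_continuousOn cθ)
    rw [intervalIntegral.integral_add (i1.const_mul _) (i2.const_mul _),
      intervalIntegral.integral_const_mul, intervalIntegral.integral_const_mul]
    have ex := hx T memT
    have ey := hy T memT
    rw [hxT, x0] at ex
    rw [hyT, y0] at ey
    simp only [Xinit, zero_add] at ex ey
    rw [← ex, ← ey]
    linear_combination L * Real.sin_sq_add_cos_sq α
  have hLT : L ≤ T := by
    rw [← hcosL]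
    have := intervalIntegral.integral_mono_on hT0 icos
      (intervalIntegrable_const (c := (1:ℝ))) fun t _ => Real.cos_le_one _
    simpa using this
  have hcint : ∫ t in (0:ℝ)..T, (1 + φ (κ t) + ψ (u t) - Real.cos (θ t - α)) ≤ C := by
    rw [intervalIntegral.integral_sub icost icos, hcosL]
    unfold cost at hcost
    linarith
  obtain ⟨a, ha0, haT, ha⟩ := exists_unit_interval hN (hNL.trans hLT) (icost.sub icos)
    (fun t => by linarith [Real.cos_le_one (θ t - α), h1.1 (κ t), h1.2.1 (u t)]) hcint hCN
  have hsub : Icc a (a + 1) ⊆ Icc 0 T := Icc_subset_Icc ha0 haT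
  have hsub' : uIcc a (a + 1) ⊆ uIcc 0 T := by
    rwa [uIcc_of_le (by linarith), uIcc_of_le hT0]
  exact exists_phase h1 h2 hρ hσ hσ1 hδ hδ₂σ hδδ₂ hφδ hψδ hε hε1 hεδ hεψ hεσ
    (fun s hs t ht => dθ s (hsub hs) t (hsub ht)) (fun s hs t ht => dκ s (hsub hs) t (hsub ht))
    (fun s hs t ht => d₃ s (hsub hs) t (hsub ht)) (fun s hs t ht => d₄ s (hsub hs) t (hsub ht))
    (cθ.mono hsub) (cκ.mono hsub) (c₃.mono hsub) (iu.mono_set hsub')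
    ((icost.sub icos).mono_set hsub') ha (ae_restrict_of_ae_restrict_of_subset hsub hu)
    (ae_restrict_of_ae_restrict_of_subset hsub hH)

/-- `|φ̂ - α| ≤ η` and `|ρ - 1| ≤ η` for optimal trajectories with
target far enough from the origin. -/
theorem phase_and_rho_limits
    (φ ψ : ℝ → ℝ) (p C₀ R₀ : ℝ)
    (h1 : H1 φ ψ) (h2 : H2 ψ) (h3 : H3 ψ p C₀ R₀)
    (η : ℝ) (hη : 0 < η) :
    ∃ R > (0:ℝ),
      ∀ (x₁ y₁ θ₁ α : ℝ), α ∈ Set.Ico 0 (2*π) →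
        x₁ = Real.sqrt (x₁^2 + y₁^2) * Real.cos α →
        y₁ = Real.sqrt (x₁^2 + y₁^2) * Real.sin α →
        R ≤ Real.sqrt (x₁^2 + y₁^2) →
      ∀ (x y θ κ u : ℝ → ℝ) (T ρ φh : ℝ) (p₃ p₄ : ℝ → ℝ),
        IsOptimal φ ψ p x y θ κ u T Xinit (x₁, y₁, θ₁, 0) →
        PMPData φ ψ θ κ u T ρ φh p₃ p₄ →
        angleDist φh α ≤ η ∧ |ρ - 1| ≤ η := by
  have hpi := Real.pi_pos
  set η' := min η π with hη'
  have hη'0 : 0 < η' := lt_min hη hpi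
  have hη'π : η' ≤ π := min_le_right _ _
  set γ := 1 - Real.cos (η' / 2) with hγ
  have hγ0 : 0 < γ := by
    have := Real.cos_lt_cos_of_nonneg_of_le_pi (x := 0) (y := η' / 2) le_rfl (by linarith)
      (by linarith)
    rw [Real.cos_zero] at this
    linarith
  obtain ⟨ν, hν0, hν1, hνη, hνγ⟩ : ∃ ν : ℝ, 0 < ν ∧ ν ≤ 1 / 8 ∧ 6 * ν ≤ η ∧ 9 * ν ≤ γ := by
    refine ⟨min (1 / 8) (min (η / 6) (γ / 9)), by positivity, min_le_left _ _, ?_, ?_⟩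
    · have := (min_le_right (1 / 8) (min (η / 6) (γ / 9))).trans (min_le_left _ _)
      linarith
    · have := (min_le_right (1 / 8) (min (η / 6) (γ / 9))).trans (min_le_right _ _)
      linarith
  set σ := ν / 151 with hσ
  have hσ0 : 0 < σ := by positivity
  have hσν : 151 * σ = ν := by rw [hσ]; ring
  obtain ⟨r₁, hr₁, hφ'⟩ := exists_deriv_small h1.2.2.1 h1.2.2.2.2.1 hσ0
  obtain ⟨r₂, hr₂, hψ'⟩ := exists_deriv_small h1.2.2.2.1 h1.2.2.2.2.2.1 hσ0
  set δ₂ := min σ r₁ with hδ₂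
  have hδ₂0 : 0 < δ₂ := lt_min hσ0 hr₁
  have hδ₂σ : δ₂ ≤ σ := min_le_left _ _
  set δ := min (δ₂ / 10) r₂ with hδ
  have hδ0 : 0 < δ := lt_min (by positivity) hr₂
  have hδδ₂ : δ ≤ δ₂ / 10 := min_le_left _ _
  have hψδ := (h1.abs_le_add h2.1 hδ0).1
  obtain ⟨ε, hε0, hε1, hε2, hε3, hε4, hε5⟩ : ∃ ε : ℝ, 0 < ε ∧ ε ≤ 1 / 10 ∧ ε ≤ δ ^ 2 / 12 ∧
      ε ≤ ψ δ / 12 ∧ ε ≤ σ / 6 ∧ ε ≤ γ / 6 :=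
    ⟨min (1 / 10) (min (δ ^ 2 / 12) (min (ψ δ / 12) (min (σ / 6) (γ / 6)))), by positivity,
      by simp, by simp, by simp, by simp, by simp⟩
  set C := 12 * (1 + φ 7 + ψ 7) + 24 with hC
  refine ⟨((⌈C / ε⌉₊ + 1 : ℕ) : ℝ), by positivity, ?_⟩
  intro x₁ y₁ θ₁ α hα hx₁ hy₁ hR x y θ κ u T ρ φh p₃ p₄ hopt hpmp
  set L := Real.sqrt (x₁ ^ 2 + y₁ ^ 2) with hL
  have hL1 : 1 ≤ L := by
    refine le_trans ?_ hR
    push_cast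
    linarith [Nat.cast_nonneg (α := ℝ) ⌈C / ε⌉₊]
  obtain ⟨x', y', θ', κ', u', T', hcon', hcost'⟩ :=
    exists_competitor (p := p) (by linarith [h3.1]) h1 hL1 hα θ₁
  have hcost : cost φ ψ κ u T ≤ L + C :=
    (hopt.2 x' y' θ' κ' u' T' (by rw [hx₁, hy₁]; exact hcon')).trans hcost'
  have hCN : C ≤ ((⌈C / ε⌉₊ + 1 : ℕ) : ℝ) * ε := by
    have := Nat.le_ceil (C / ε)
    rw [div_le_iff₀ hε0] at this
    push_cast
    linarith
  have hcon : Connects p x y θ κ u T Xinit (L * Real.cos α, L * Real.sin α, θ₁, 0) := by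
    rw [← hx₁, ← hy₁]
    exact hopt.1
  obtain ⟨β, hβ, hs, hc⟩ := exists_phase_of_optimal h3.1 h1 (Nat.succ_pos _) hCN hR hcon hcost
    hpmp h2.1 hσ0 (by linarith) hδ0 hδ₂σ (by linarith)
    (fun x hx => hφ' x (hx.trans (min_le_right _ _)))
    (fun x hx => hψ' x (hx.trans (min_le_right _ _))) hε0 hε1 (by linarith) (by linarith)
    (by linarith)
  rw [hσν] at hs hc
  obtain ⟨hρ1, hcos⟩ := polar_close hpmp.1 hν0 hν1 hs hc
  refine ⟨?_, hρ1.trans hνη⟩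
  have a1 : ‖((φh - β : ℝ) : Real.Angle)‖ ≤ η' / 2 := by
    refine norm_coe_angle_le (by positivity) ?_
    rw [← neg_sub, Real.cos_neg]
    linarith
  have a2 : ‖((β - α : ℝ) : Real.Angle)‖ ≤ η' / 2 :=
    norm_coe_angle_le (by positivity) (by linarith)
  have e : ((φh - α : ℝ) : Real.Angle)
      = ((φh - β : ℝ) : Real.Angle) + ((β - α : ℝ) : Real.Angle) := by
    rw [← Real.Angle.coe_add, sub_add_sub_cancel]
  have := norm_add_le ((φh - β : ℝ) : Real.Angle) ((β - α : ℝ) : Real.Angle)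
  unfold angleDist
  rw [e]
  linarith [min_le_left η π]

end
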